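/- Let d ≥ 2, ε ∈ (0,1), D₁ > 0, and let φ : ℝ^d × [0,∞) → ℝ be a smooth ℤ^d-periodic (in x) function with |φ| ≤ 1 and σ^{−1}∫_Ω ( ε|∇φ(·,t)|²/2 + W(φ(·,t))/ε ) dx ≤ D₁ for all t ≥ 0. Then for all 0 ≤ t₁ < t₂: ∫_Ω |k(φ(x,t₂)) − k(φ(x,t₁))| dx ≤ ( 2σD₁ (t₂ − t₁) )^{1/2} ( ∫_{t₁}^{t₂} ∫_Ω ε(∂_tφ)² dx dt )^{1/2}. -/

import Mathlib

open MeasureTheory Real Set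

noncomputable section

/-- Euclidean space ℝ^d. -/
abbrev Ed (d : ℕ) := EuclideanSpace ℝ (Fin d)

/-- The double-well potential W(s) = (1-s²)²/2. -/
def W (s : ℝ) : ℝ := (1 - s ^ 2) ^ 2 / 2

/-- Its derivative W'(s) = 2s³ - 2s. -/
def W' (s : ℝ) : ℝ := 2 * s ^ 3 - 2 * s

/-- Standard basis vector of ℝ^d. -/
def ebasis (d : ℕ) (i : Fin d) : Ed d := EuclideanSpace.single i 1

/-- The Laplacian, as the sum of second partial derivatives. -/
def lap {d : ℕ} (f : Ed d → ℝ) (x : Ed d) : ℝ :=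
  ∑ i, fderiv ℝ (fun y => fderiv ℝ f y (ebasis d i)) x (ebasis d i)

/-- ℤ^d-periodicity. -/
def ZdPeriodic {d : ℕ} {α : Type*} (f : Ed d → α) : Prop :=
  ∀ (x : Ed d) (k : Fin d → ℤ), f (x + (WithLp.equiv 2 (Fin d → ℝ)).symm fun i => (k i : ℝ)) = f x

/-- k(s) = ∫₀ˢ √(2W) = s - s³/3. -/
def kk (s : ℝ) : ℝ := s - s ^ 3 / 3

/-- The unit cube Ω = [0,1)^d. -/
def cube (d : ℕ) : Set (Ed d) := {x | ∀ i, x i ∈ Set.Ico (0 : ℝ) 1}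

/-- σ = ∫_{-1}^1 √(2W) = 4/3. -/
def sig : ℝ := 4 / 3

lemma cube_measurable (d : ℕ) : MeasurableSet (cube d) := by
  unfold cube
  simp only [Set.ofPred_forall]
  refine MeasurableSet.iInter fun i => ?_
  have : Measurable (fun x : Ed d => x i) := by fun_prop
  exact this measurableSet_Ico

lemma cube_sub_ball (d : ℕ) : ∃ K : Set (Ed d), IsCompact K ∧ cube d ⊆ K := by
  refine ⟨Set.image (WithLp.toLp 2) (Set.Icc (0 : Fin d → ℝ) 1), ?_, ?_⟩
  · exact isCompact_Icc.image (PiLp.continuous_toLp 2 _)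
  · intro x hx
    exact ⟨WithLp.ofLp x, ⟨fun i => (hx i).1, fun i => (hx i).2.le⟩, rfl⟩

lemma integrableOn_cube {d : ℕ} {f : Ed d → ℝ} (hf : Continuous f) :
    IntegrableOn f (cube d) := by
  obtain ⟨K, hK, hs⟩ := cube_sub_ball d
  exact (hf.continuousOn.integrableOn_compact hK).mono_set hs

lemma integrable_cube_prod {d : ℕ} {f : Ed d × ℝ → ℝ} (hf : Continuous f) (a b : ℝ) :
    Integrable f ((volume.restrict (cube d)).prod (volume.restrict (Set.Ioc a b))) := by
  obtain ⟨K, hK, hs⟩ := cube_sub_ball d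
  rw [Measure.prod_restrict]
  exact (hf.continuousOn.integrableOn_compact (hK.prod (isCompact_Icc (a := a) (b := b)))).mono_set
    (Set.prod_mono hs Set.Ioc_subset_Icc_self)

lemma hasDerivAt_time {d : ℕ} {φ : Ed d → ℝ → ℝ}
    (hφ : ContDiff ℝ (⊤ : ℕ∞) (fun p : Ed d × ℝ => φ p.1 p.2)) (x : Ed d) (t : ℝ) :
    HasDerivAt (φ x) (fderiv ℝ (fun p : Ed d × ℝ => φ p.1 p.2) (x, t) (0, 1)) t := by
  have h1 := ((hφ.differentiable (by simp)) (x, t)).hasFDerivAt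
  have h2 : HasDerivAt (fun s : ℝ => (x, s)) ((0 : Ed d), (1 : ℝ)) t :=
    (hasDerivAt_const t x).prodMk (hasDerivAt_id t)
  exact h1.comp_hasDerivAt t h2

lemma continuous_time_deriv {d : ℕ} {φ : Ed d → ℝ → ℝ}
    (hφ : ContDiff ℝ (⊤ : ℕ∞) (fun p : Ed d × ℝ => φ p.1 p.2)) :
    Continuous (fun p : Ed d × ℝ => deriv (φ p.1) p.2) := by
  have : (fun p : Ed d × ℝ => deriv (φ p.1) p.2) =
      fun p => fderiv ℝ (fun p : Ed d × ℝ => φ p.1 p.2) p (0, 1) := by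
    ext p
    exact (hasDerivAt_time hφ p.1 p.2).deriv
  rw [this]
  exact (hφ.continuous_fderiv (by simp)).clm_apply continuous_const

lemma continuous_gradient_norm {d : ℕ} {φ : Ed d → ℝ → ℝ}
    (hφ : ContDiff ℝ (⊤ : ℕ∞) (fun p : Ed d × ℝ => φ p.1 p.2)) (t : ℝ) :
    Continuous (fun x => ‖gradient (fun y => φ y t) x‖) := by
  have h : ContDiff ℝ (⊤ : ℕ∞) (fun y => φ y t) :=
    hφ.comp (contDiff_id.prodMk contDiff_const)
  have : (fun x => ‖gradient (fun y => φ y t) x‖) = fun x => ‖fderiv ℝ (fun y => φ y t) x‖ := by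
    ext x
    simp [gradient]
  rw [this]
  exact (h.continuous_fderiv (by simp)).norm

/-- Hölder continuity in time of ∫ k(φ). -/
theorem k_holder_in_time {d : ℕ} (hd : 2 ≤ d) (ε : ℝ) (hε : ε ∈ Set.Ioo (0 : ℝ) 1)
    (D₁ : ℝ) (hD₁ : 0 < D₁)
    (φ : Ed d → ℝ → ℝ)
    (hφ : ContDiff ℝ (⊤ : ℕ∞) (fun p : Ed d × ℝ => φ p.1 p.2))
    (hper : ∀ t, ZdPeriodic fun x => φ x t)
    (hbd : ∀ (x : Ed d) (t : ℝ), |φ x t| ≤ 1)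
    (henergy : ∀ t : ℝ, 0 ≤ t →
      sig⁻¹ * ∫ x in cube d,
        (ε * ‖gradient (fun y => φ y t) x‖ ^ 2 / 2 + W (φ x t) / ε) ≤ D₁) :
    ∀ t₁ t₂ : ℝ, 0 ≤ t₁ → t₁ < t₂ →
      (∫ x in cube d, |kk (φ x t₂) - kk (φ x t₁)|)
        ≤ Real.sqrt (2 * sig * D₁ * (t₂ - t₁))
            * Real.sqrt (∫ t in t₁..t₂, ∫ x in cube d, ε * (deriv (φ x) t) ^ 2) := by
  intro t₁ t₂ h0 h12
  have hε0 : 0 < ε := hε.1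
  set f : Ed d × ℝ → ℝ := fun p => 1 - φ p.1 p.2 ^ 2 with hf
  set g : Ed d × ℝ → ℝ := fun p => |deriv (φ p.1) p.2| with hg
  have hΦ : Continuous (fun p : Ed d × ℝ => φ p.1 p.2) := hφ.continuous
  have hfc : Continuous f := by fun_prop
  have hdc := continuous_time_deriv hφ
  have hgc : Continuous g := hdc.abs
  have hf0 : ∀ p, 0 ≤ f p := fun p => by
    have := abs_le.1 (hbd p.1 p.2)
    simp only [hf]; nlinarith
  have hgs : ∀ p, g p ^ 2 = deriv (φ p.1) p.2 ^ 2 := fun p => sq_abs _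
  set m := (volume.restrict (cube d)).prod (volume.restrict (Set.Ioc t₁ t₂)) with hm
  have iF : Integrable (fun p => f p ^ 2 / ε) m := integrable_cube_prod (by fun_prop) _ _
  have iG : Integrable (fun p => ε * g p ^ 2) m := integrable_cube_prod (by fun_prop) _ _
  have iFG : Integrable (fun p => f p * g p) m := integrable_cube_prod (by fun_prop) _ _
  have hxc : ∀ x : Ed d, Continuous (fun t => f (x, t) * g (x, t)) := fun x => by fun_prop
  -- pointwise fundamental theorem of calculus
  have hpt : ∀ x : Ed d, |kk (φ x t₂) - kk (φ x t₁)| ≤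
      ∫ t in Set.Ioc t₁ t₂, f (x, t) * g (x, t) := by
    intro x
    have hder : ∀ t, HasDerivAt (fun s => kk (φ x s)) (f (x, t) * deriv (φ x) t) t := by
      intro t
      have h1 := (hasDerivAt_time hφ x t).differentiableAt.hasDerivAt
      have h2 := h1.sub ((h1.pow 3).div_const 3)
      refine h2.congr_deriv ?_
      simp only [hf]; norm_num; ring
    have hc : Continuous (fun t => f (x, t) * deriv (φ x) t) := by
      have : Continuous (fun t => deriv (φ x) t) :=
        hdc.comp (Continuous.prodMk_right x)
      fun_prop
    rw [← intervalIntegral.integral_eq_sub_of_hasDerivAt (fun t _ => hder t)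
      (hc.intervalIntegrable _ _), ← intervalIntegral.integral_of_le h12.le]
    refine (intervalIntegral.abs_integral_le_integral_abs h12.le).trans (le_of_eq ?_)
    refine intervalIntegral.integral_congr fun t _ => ?_
    simp only [abs_mul, abs_of_nonneg (hf0 (x, t)), hg]
  have hI : (∫ x in cube d, |kk (φ x t₂) - kk (φ x t₁)|) ≤ ∫ p, f p * g p ∂m := by
    rw [hm, integral_prod _ iFG]
    refine integral_mono ?_ iFG.integral_prod_left hpt
    have hc : ∀ t, Continuous (fun x => φ x t) := fun t =>
      hΦ.comp (Continuous.prodMk_left t)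
    refine integrableOn_cube ?_
    unfold kk
    have := hc t₁
    have := hc t₂
    fun_prop
  have hA : (∫ t in t₁..t₂, ∫ x in cube d, ε * (deriv (φ x) t) ^ 2) = ∫ p, ε * g p ^ 2 ∂m := by
    rw [hm, integral_prod_symm _ iG, intervalIntegral.integral_of_le h12.le]
    simp only [hgs]
  have hB : (∫ p, f p ^ 2 / ε ∂m) ≤ 2 * sig * D₁ * (t₂ - t₁) := by
    rw [hm, integral_prod_symm _ iF]
    have hle : ∀ t ∈ Set.Ioc t₁ t₂, (∫ x in cube d, f (x, t) ^ 2 / ε) ≤ 2 * sig * D₁ := by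
      intro t ht
      have he := henergy t (h0.trans ht.1.le)
      have hs : (0 : ℝ) < sig := by norm_num [sig]
      rw [inv_mul_le_iff₀ hs] at he
      have hgr := continuous_gradient_norm hφ t
      have hc : Continuous (fun x => φ x t) := hΦ.comp (Continuous.prodMk_left t)
      have : (∫ x in cube d, f (x, t) ^ 2 / ε) ≤ ∫ x in cube d,
          2 * (ε * ‖gradient (fun y => φ y t) x‖ ^ 2 / 2 + W (φ x t) / ε) := by
        refine integral_mono (integrableOn_cube (by fun_prop))
          (integrableOn_cube (by unfold W; fun_prop)) fun x => ?_
        have : 0 ≤ ε * ‖gradient (fun y => φ y t) x‖ ^ 2 := by positivity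
        have h2 : f (x, t) ^ 2 / ε = 2 * (W (φ x t) / ε) := by
          simp only [hf, W]; ring
        simp only [h2]
        linarith
      rw [integral_const_mul] at this
      linarith
    calc _ ≤ ∫ t in Set.Ioc t₁ t₂, 2 * sig * D₁ :=
          setIntegral_mono_on iF.integral_prod_right (integrable_const _) measurableSet_Ioc hle
      _ = _ := by
          simp [h12.le]; ring
  have hcs : (∫ p, f p * g p ∂m) ^ 2 ≤ (∫ p, f p ^ 2 / ε ∂m) * ∫ p, ε * g p ^ 2 ∂m := by
    have hq : ∀ l : ℝ, 0 ≤ (∫ p, f p ^ 2 / ε ∂m) * (l * l) + (-2 * ∫ p, f p * g p ∂m) * l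
        + ∫ p, ε * g p ^ 2 ∂m := by
      intro l
      have h1 : 0 ≤ ∫ p, (l * l) * (f p ^ 2 / ε) + (-2 * l) * (f p * g p) + ε * g p ^ 2 ∂m := by
        refine integral_nonneg fun p => ?_
        have : (l * l) * (f p ^ 2 / ε) + (-2 * l) * (f p * g p) + ε * g p ^ 2
            = (l * f p - ε * g p) ^ 2 / ε := by
          field_simp; ring
        simp only [this]
        positivity
      have i2 : Integrable (fun p => (l * l) * (f p ^ 2 / ε) + (-2 * l) * (f p * g p)) m :=
        (iF.const_mul _).add (iFG.const_mul _)
      rw [integral_add i2 iG,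
        integral_add (iF.const_mul _) (iFG.const_mul _), integral_const_mul,
        integral_const_mul] at h1
      linarith
    have := discrim_le_zero hq
    unfold discrim at this
    nlinarith
  rw [hA]
  have hG0 : 0 ≤ ∫ p, ε * g p ^ 2 ∂m := integral_nonneg fun p => by
    simp only [Pi.zero_apply]; positivity
  have hB0 : 0 ≤ ∫ p, f p ^ 2 / ε ∂m := integral_nonneg fun p => by
    simp only [Pi.zero_apply]; positivity
  refine hI.trans ?_
  rw [← Real.sqrt_mul (hB0.trans hB)]
  exact Real.le_sqrt_of_sq_le (hcs.trans (mul_le_mul_of_nonneg_right hB hG0))
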